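/- Let G be a finite simple graph, S ⊆ V(G) with G[S] a cograph, f : S → ℤ≥2, and define b(X) = |Γ_G(X)| − c_{G[S]}(X) + 2|X| − f(X) for nonempty X ⊆ S. Assume b(X) ≥ 1 for all nonempty X ⊆ S. Call X tight if b(X) = 1. If A and B are intersecting tight sets, then A∩B and A∪B are tight and U(A,B) = ∅, where U(A,B) is the set of vertices outside A∪B adjacent to both A∖B and B∖A but not to A∩B. -/

import Mathlib

/-- A cograph: a graph with no induced path on four vertices. -/
def IsCograph {V : Type*} (G : SimpleGraph V) : Prop :=
  ∀ a b c d : V, a ≠ b → a ≠ c → a ≠ d → b ≠ c → b ≠ d → c ≠ d →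
    ¬ (G.Adj a b ∧ G.Adj b c ∧ G.Adj c d ∧ ¬G.Adj a c ∧ ¬G.Adj a d ∧ ¬G.Adj b d)

/-- The open neighborhood of a finite vertex set `X` in `G`. -/
def openNbhd {V : Type*} (G : SimpleGraph V) (X : Finset V) : Set V :=
  {v : V | v ∉ X ∧ ∃ x ∈ X, G.Adj x v}

/-- Number of connected components of the subgraph induced by `X`. -/
noncomputable def numComponents {V : Type*} (G : SimpleGraph V) (X : Finset V) : ℕ :=
  Nat.card (G.induce (X : Set V)).ConnectedComponent

/-- `b(X) = |Γ_G(X)| − c(G[X]) + 2|X| − f(X)`. -/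
noncomputable def bFun {V : Type*} (G : SimpleGraph V) (f : V → ℤ) (X : Finset V) : ℤ :=
  (Nat.card (openNbhd G X) : ℤ) - numComponents G X + 2 * X.card - ∑ x ∈ X, f x

/-- `U(A,B)`: vertices outside `A ∪ B` adjacent to both `A \ B` and `B \ A`
but not to `A ∩ B`. -/
def Uset {V : Type*} [DecidableEq V] (G : SimpleGraph V) (A B : Finset V) : Set V :=
  {w : V | w ∉ A ∪ B ∧ (∃ a ∈ A \ B, G.Adj a w) ∧ (∃ b ∈ B \ A, G.Adj b w) ∧
    ¬ ∃ c ∈ A ∩ B, G.Adj c w}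

open Classical in
/-- The vertices reachable from `v` through `Y`. -/
noncomputable def componentOf {V : Type*} [Fintype V] (G : SimpleGraph V) (Y : Finset V) (v : V) :
    Finset V :=
  Finset.univ.filter (Relation.ReflTransGen (fun a b => a ∈ Y ∧ b ∈ Y ∧ G.Adj a b) v)

section

variable {V : Type*} [Fintype V] {G : SimpleGraph V} {X Y : Finset V} {u v w : V}

theorem mem_componentOf :
    w ∈ componentOf G Y v ↔
      Relation.ReflTransGen (fun a b => a ∈ Y ∧ b ∈ Y ∧ G.Adj a b) v w := by
  simp [componentOf]

theorem self_mem_componentOf : v ∈ componentOf G Y v :=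
  mem_componentOf.2 .refl

theorem adj_mem_componentOf (h : u ∈ componentOf G Y v) (hu : u ∈ Y) (hw : w ∈ Y)
    (huw : G.Adj u w) : w ∈ componentOf G Y v :=
  mem_componentOf.2 ((mem_componentOf.1 h).tail ⟨hu, hw, huw⟩)

theorem componentOf_subset (hv : v ∈ Y) : componentOf G Y v ⊆ Y := by
  intro w hw
  induction mem_componentOf.1 hw with
  | refl => exact hv
  | tail _ h _ => exact h.2.1

theorem mem_componentOf_symm (h : w ∈ componentOf G Y v) : v ∈ componentOf G Y w := by
  rw [mem_componentOf] at *
  have : Std.Symm fun a b => a ∈ Y ∧ b ∈ Y ∧ G.Adj a b :=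
    ⟨fun a b h => ⟨h.2.1, h.1, h.2.2.symm⟩⟩
  exact Std.Symm.symm _ _ h

theorem componentOf_eq_iff : componentOf G Y v = componentOf G Y w ↔ w ∈ componentOf G Y v := by
  refine ⟨fun h => h ▸ self_mem_componentOf, fun h => ?_⟩
  have h' := mem_componentOf_symm h
  ext x
  rw [mem_componentOf] at h h'
  simp only [mem_componentOf]
  exact ⟨fun hx => h'.trans hx, fun hx => h.trans hx⟩

theorem componentOf_mono (h : X ⊆ Y) : componentOf G X v ⊆ componentOf G Y v := by
  intro w hw
  rw [mem_componentOf] at *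
  exact Relation.ReflTransGen.mono (fun a b hab => ⟨h hab.1, h hab.2.1, hab.2.2⟩) _ _ hw

theorem induce_reachable_iff (v w : (Y : Set V)) :
    (G.induce (Y : Set V)).Reachable v w ↔ (w : V) ∈ componentOf G Y v := by
  rw [SimpleGraph.reachable_iff_reflTransGen, mem_componentOf]
  constructor
  · exact Relation.ReflTransGen.lift (p := fun a b => a ∈ Y ∧ b ∈ Y ∧ G.Adj a b)
      Subtype.val (fun a b h => ⟨a.2, b.2, h⟩) _ _
  · obtain ⟨w, hw⟩ := w
    intro h
    change Relation.ReflTransGen _ (v : V) w at h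
    induction h with
    | refl => exact .refl
    | tail _ h ih => exact (ih h.1).tail h.2.2

theorem numComponents_eq_card_image [DecidableEq V] (G : SimpleGraph V) (Y : Finset V) :
    numComponents G Y = (Y.image (componentOf G Y)).card := by
  rw [numComponents, ← Nat.card_eq_finsetCard]
  refine Nat.card_congr (Equiv.ofBijective (Quot.lift
    (fun v => ⟨componentOf G Y v, Finset.mem_image_of_mem _ v.2⟩) fun v w h => ?_) ⟨?_, ?_⟩)
  · exact Subtype.ext (componentOf_eq_iff.2 ((induce_reachable_iff v w).1 h))
  · rintro ⟨v⟩ ⟨w⟩ h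
    exact Quot.sound ((induce_reachable_iff v w).2
      (componentOf_eq_iff.1 (congrArg Subtype.val h)))
  · rintro ⟨C, hC⟩
    obtain ⟨v, hv, rfl⟩ := Finset.mem_image.1 hC
    exact ⟨Quot.mk _ ⟨v, hv⟩, rfl⟩

/-- In a cograph, connected vertices are at distance at most two. -/
theorem IsCograph.eq_or_adj_or_common (hcog : IsCograph (G.induce (X : Set V))) (hYX : Y ⊆ X)
    (hv : v ∈ Y) (h : w ∈ componentOf G Y v) :
    v = w ∨ G.Adj v w ∨ ∃ z ∈ Y, G.Adj v z ∧ G.Adj z w := by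
  rw [mem_componentOf] at h
  induction h with
  | refl => exact .inl rfl
  | @tail y w _ hyw ih =>
    obtain ⟨hy, hw, hyw⟩ := hyw
    rcases ih with rfl | ih | ⟨z, hz, hvz, hzy⟩
    · exact .inr (.inl hyw)
    · exact .inr (.inr ⟨y, hy, ih, hyw⟩)
    · by_contra! hcon
      obtain ⟨h1, h2, h3⟩ := hcon
      have hvy : ¬ G.Adj v y := fun h => h3 y hy h hyw
      have hzw : ¬ G.Adj z w := h3 z hz hvz
      refine hcog ⟨v, hYX hv⟩ ⟨z, hYX hz⟩ ⟨y, hYX hy⟩ ⟨w, hYX hw⟩ ?_ ?_ ?_ ?_ ?_ ?_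
        ⟨hvz, hzy, hyw, hvy, h2, hzw⟩ <;> rw [Ne, Subtype.mk.injEq]
      · exact hvz.ne
      · rintro rfl; exact h2 hyw
      · exact h1
      · exact hzy.ne
      · rintro rfl; exact h2 hvz
      · exact hyw.ne

end

theorem Finset.card_image_add_card_image_le {ι α β γ δ : Type*} [DecidableEq ι] [DecidableEq α]
    [DecidableEq β] [DecidableEq γ] [DecidableEq δ] (s : Finset ι) (a : ι → α) (b : ι → β)
    (c : ι → γ) (d : ι → δ)
    (hc : ∀ x ∈ s, ∀ y ∈ s, c x = c y → a x = a y ∨ b x = b y)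
    (hd : ∀ x ∈ s, ∀ y ∈ s, d x = d y → a x = a y ∧ b x = b y) :
    (s.image a).card + (s.image b).card ≤ (s.image c).card + (s.image d).card := by
  induction s using Finset.induction_on with
  | empty => simp
  | insert x s hx ih =>
    have ih := ih (fun y hy z hz => hc y (by simp [hy]) z (by simp [hz]))
      (fun y hy z hz => hd y (by simp [hy]) z (by simp [hz]))
    have hc' : c x ∈ s.image c → a x ∈ s.image a ∨ b x ∈ s.image b := by
      simp only [Finset.mem_image]
      rintro ⟨y, hy, h⟩
      exact (hc y (by simp [hy]) x (by simp) h).imp (⟨y, hy, ·⟩) (⟨y, hy, ·⟩)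
    have hd' : d x ∈ s.image d → a x ∈ s.image a ∧ b x ∈ s.image b := by
      simp only [Finset.mem_image]
      rintro ⟨y, hy, h⟩
      exact (hd y (by simp [hy]) x (by simp) h).imp (⟨y, hy, ·⟩) (⟨y, hy, ·⟩)
    simp only [Finset.image_insert, Finset.card_insert_eq_ite]
    split_ifs <;> first | omega | tauto

open Classical in
/-- The vertices of `A \ B` adjacent to `B \ A` but not to `A ∩ B`. -/
noncomputable def crossSet {V : Type*} [DecidableEq V] (G : SimpleGraph V) (A B : Finset V) :
    Finset V :=
  (A \ B).filter fun v => (∃ b ∈ B \ A, G.Adj b v) ∧ ¬ ∃ x ∈ A ∩ B, G.Adj x v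

section

variable {V : Type*} [Fintype V] [DecidableEq V] {G : SimpleGraph V}

theorem componentOf_union_eq {A B : Finset V} {v : V} (hv : v ∈ A)
    (hAB : Disjoint (componentOf G A v) (A ∩ B))
    (hcross : Disjoint (componentOf G A v) (crossSet G A B)) :
    componentOf G (A ∪ B) v = componentOf G A v := by
  rw [Finset.disjoint_left] at hAB hcross
  refine (Finset.Subset.antisymm (componentOf_mono Finset.subset_union_left) ?_).symm
  intro w hw
  induction mem_componentOf.1 hw with
  | refl => exact self_mem_componentOf
  | @tail y w hvy h ih =>
    have hy := ih (mem_componentOf.2 hvy)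
    have hyA := componentOf_subset hv hy
    by_cases hwA : w ∈ A
    · exact adj_mem_componentOf hy hyA hwA h.2.2
    · have hyB : y ∉ B := fun hyB => hAB hy (Finset.mem_inter.2 ⟨hyA, hyB⟩)
      have hwB : w ∈ B := by simpa [hwA] using h.2.1
      refine absurd ?_ (hcross hy)
      simp only [crossSet, Finset.mem_filter, Finset.mem_sdiff]
      refine ⟨⟨hyA, hyB⟩, ⟨w, ⟨hwB, hwA⟩, h.2.2.symm⟩, ?_⟩
      rintro ⟨x, hx, hxy⟩
      exact hAB (adj_mem_componentOf hy hyA (Finset.mem_inter.1 hx).1 hxy.symm) hx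

theorem numComponents_le (G : SimpleGraph V) (A B : Finset V) :
    numComponents G A ≤ ((A ∩ B).image (componentOf G A)).card + (crossSet G A B).card +
      (((A ∪ B).image (componentOf G (A ∪ B))).filter (· ⊆ A \ B)).card := by
  rw [numComponents_eq_card_image]
  have hsub : A.image (componentOf G A) ⊆
      ((A ∩ B).image (componentOf G A) ∪ (crossSet G A B).image (componentOf G A)) ∪
        ((A ∪ B).image (componentOf G (A ∪ B))).filter (· ⊆ A \ B) := by
    intro C hC
    obtain ⟨v, hv, rfl⟩ := Finset.mem_image.1 hC
    have himage : ∀ s : Finset V, ¬ Disjoint (componentOf G A v) s →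
        componentOf G A v ∈ s.image (componentOf G A) := by
      intro s hs
      obtain ⟨w, hw, hws⟩ := Finset.not_disjoint_iff.1 hs
      exact Finset.mem_image.2 ⟨w, hws, (componentOf_eq_iff.2 hw).symm⟩
    by_cases h1 : Disjoint (componentOf G A v) (A ∩ B)
    · by_cases h2 : Disjoint (componentOf G A v) (crossSet G A B)
      · refine Finset.mem_union_right _ (Finset.mem_filter.2 ⟨Finset.mem_image.2
          ⟨v, Finset.mem_union_left _ hv, componentOf_union_eq hv h1 h2⟩, fun w hw => ?_⟩)
        have hwA := componentOf_subset hv hw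
        exact Finset.mem_sdiff.2 ⟨hwA, fun hwB =>
          Finset.disjoint_left.1 h1 hw (Finset.mem_inter.2 ⟨hwA, hwB⟩)⟩
      · exact Finset.mem_union_left _ (Finset.mem_union_right _ (himage _ h2))
    · exact Finset.mem_union_left _ (Finset.mem_union_left _ (himage _ h1))
  have h1 := Finset.card_le_card hsub
  have h2 := Finset.card_union_le
    ((A ∩ B).image (componentOf G A) ∪ (crossSet G A B).image (componentOf G A))
    (((A ∪ B).image (componentOf G (A ∪ B))).filter (· ⊆ A \ B))
  have h3 := Finset.card_union_le ((A ∩ B).image (componentOf G A))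
    ((crossSet G A B).image (componentOf G A))
  have h4 : ((crossSet G A B).image (componentOf G A)).card ≤ _ := Finset.card_image_le
  omega

theorem le_numComponents_union (G : SimpleGraph V) (A B : Finset V) :
    ((A ∩ B).image (componentOf G (A ∪ B))).card +
      (((A ∪ B).image (componentOf G (A ∪ B))).filter (· ⊆ A \ B)).card +
      (((A ∪ B).image (componentOf G (A ∪ B))).filter (· ⊆ B \ A)).card ≤
    numComponents G (A ∪ B) := by
  rw [numComponents_eq_card_image, ← Finset.card_union_of_disjoint,
    ← Finset.card_union_of_disjoint]
  · refine Finset.card_le_card (Finset.union_subset (Finset.union_subset ?_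
      (Finset.filter_subset _ _)) (Finset.filter_subset _ _))
    exact Finset.image_subset_image fun x hx => by simp_all
  · rw [Finset.disjoint_left]
    intro C hC hC'
    obtain ⟨hC', hCB⟩ := Finset.mem_filter.1 hC'
    obtain ⟨v, hv, rfl⟩ := Finset.mem_image.1 hC'
    have hvB := hCB self_mem_componentOf
    rcases Finset.mem_union.1 hC with hC | hC
    · obtain ⟨x, hx, hxv⟩ := Finset.mem_image.1 hC
      have := hCB (hxv ▸ self_mem_componentOf : x ∈ _)
      simp_all
    · have := (Finset.mem_filter.1 hC).2 self_mem_componentOf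
      simp_all
  · rw [Finset.disjoint_left]
    intro C hC hC'
    have hCB := (Finset.mem_filter.1 hC').2
    obtain ⟨x, hx, rfl⟩ := Finset.mem_image.1 hC
    have := hCB self_mem_componentOf
    simp_all

theorem IsCograph.numComponents_add_le {S : Finset V} (hcog : IsCograph (G.induce (S : Set V)))
    {A B : Finset V} (hA : A ⊆ S) (hB : B ⊆ S) :
    numComponents G A + numComponents G B ≤
      numComponents G (A ∪ B) + numComponents G (A ∩ B) +
        (crossSet G A B).card + (crossSet G B A).card := by
  have h1 := numComponents_le G A B
  have h2 := numComponents_le G B A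
  have h3 := le_numComponents_union G A B
  have h4 := numComponents_eq_card_image G (A ∩ B)
  rw [Finset.union_comm, Finset.inter_comm] at h2
  have h5 := Finset.card_image_add_card_image_le (A ∩ B) (componentOf G A) (componentOf G B)
    (componentOf G (A ∪ B)) (componentOf G (A ∩ B)) ?_ ?_
  · omega
  · intro x hx y hy hxy
    obtain ⟨hxA, hxB⟩ := Finset.mem_inter.1 hx
    obtain ⟨hyA, hyB⟩ := Finset.mem_inter.1 hy
    simp only [componentOf_eq_iff] at hxy ⊢
    rcases hcog.eq_or_adj_or_common (Finset.union_subset hA hB)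
      (Finset.mem_union_left _ hxA) hxy with rfl | h | ⟨z, hz, hxz, hzy⟩
    · exact .inl self_mem_componentOf
    · exact .inl (adj_mem_componentOf self_mem_componentOf hxA hyA h)
    · refine (Finset.mem_union.1 hz).imp (fun hz => ?_) fun hz => ?_
      · exact adj_mem_componentOf (adj_mem_componentOf self_mem_componentOf hxA hz hxz) hz hyA hzy
      · exact adj_mem_componentOf (adj_mem_componentOf self_mem_componentOf hxB hz hxz) hz hyB hzy
  · intro x _ y _ hxy
    simp only [componentOf_eq_iff] at hxy ⊢
    exact ⟨componentOf_mono Finset.inter_subset_left hxy,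
      componentOf_mono Finset.inter_subset_right hxy⟩

theorem card_openNbhd_add_le (G : SimpleGraph V) (A B : Finset V) :
    Nat.card (openNbhd G (A ∪ B)) + Nat.card (openNbhd G (A ∩ B)) + Nat.card (Uset G A B) +
        (crossSet G A B).card + (crossSet G B A).card ≤
      Nat.card (openNbhd G A) + Nat.card (openNbhd G B) := by
  classical
  have hcard (s : Set V) : Nat.card s = ∑ v, if v ∈ s then 1 else 0 := by
    rw [← Finset.card_filter, Nat.card_eq_fintype_card, Fintype.card_subtype]
  have hcard' (s : Finset V) : s.card = ∑ v, if v ∈ s then 1 else 0 := by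
    simp
  simp only [hcard, hcard', ← Finset.sum_add_distrib]
  refine Finset.sum_le_sum fun v _ => ?_
  have hA : (∃ x ∈ A, G.Adj x v) ↔ (∃ x ∈ A \ B, G.Adj x v) ∨ ∃ x ∈ A ∩ B, G.Adj x v := by
    simp only [Finset.mem_sdiff, Finset.mem_inter]; grind
  have hB : (∃ x ∈ B, G.Adj x v) ↔ (∃ x ∈ B \ A, G.Adj x v) ∨ ∃ x ∈ A ∩ B, G.Adj x v := by
    simp only [Finset.mem_sdiff, Finset.mem_inter]; grind
  have hAB : (∃ x ∈ A ∪ B, G.Adj x v) ↔ (∃ x ∈ A, G.Adj x v) ∨ ∃ x ∈ B, G.Adj x v := by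
    simp only [Finset.mem_union]; grind
  simp only [openNbhd, Uset, crossSet, Set.mem_ofPred_eq, Finset.mem_filter, hAB, hA, hB,
    Finset.inter_comm B A]
  clear hA hB hAB
  by_cases hp : ∃ x ∈ A \ B, G.Adj x v <;> by_cases hq : ∃ x ∈ B \ A, G.Adj x v <;>
    by_cases hr : ∃ x ∈ A ∩ B, G.Adj x v <;> by_cases hvA : v ∈ A <;> by_cases hvB : v ∈ B <;>
    simp only [hp, hq, hr] <;> simp [hvA, hvB]

theorem IsCograph.bFun_submodular {S : Finset V} (hcog : IsCograph (G.induce (S : Set V)))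
    (f : V → ℤ) {A B : Finset V} (hA : A ⊆ S) (hB : B ⊆ S) :
    bFun G f (A ∪ B) + bFun G f (A ∩ B) + Nat.card (Uset G A B) ≤ bFun G f A + bFun G f B := by
  have h1 := hcog.numComponents_add_le hA hB
  have h2 := card_openNbhd_add_le G A B
  have h3 := Finset.card_union_add_card_inter A B
  have h4 := Finset.sum_union_inter (s₁ := A) (s₂ := B) (f := f)
  simp only [bFun]
  omega

end

/-- Intersection and union of two intersecting tight sets are tight, and
`U(A,B) = ∅`. -/
theorem tight_intersecting
    {V : Type*} [Fintype V] [DecidableEq V] (G : SimpleGraph V) (S : Finset V)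
    (f : V → ℤ) (hf : ∀ v ∈ S, 2 ≤ f v)
    (hcog : IsCograph (G.induce (S : Set V)))
    (hcond : ∀ X : Finset V, X ⊆ S → X.Nonempty → 1 ≤ bFun G f X)
    (A B : Finset V) (hA : A ⊆ S) (hB : B ⊆ S)
    (hAB : (A ∩ B).Nonempty)
    (htA : bFun G f A = 1) (htB : bFun G f B = 1) :
    bFun G f (A ∩ B) = 1 ∧ bFun G f (A ∪ B) = 1 ∧ Uset G A B = ∅ := by
  have hsub := hcog.bFun_submodular f hA hB
  have hinter := hcond (A ∩ B) (Finset.inter_subset_left.trans hA) hAB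
  have hunion := hcond (A ∪ B) (Finset.union_subset hA hB)
    (hAB.mono (Finset.inter_subset_left.trans Finset.subset_union_left))
  refine ⟨by omega, by omega, ?_⟩
  have hU : Nat.card (Uset G A B) = 0 := by omega
  rw [Nat.card_coe_set_eq] at hU
  exact (Set.ncard_eq_zero (Set.toFinite _)).1 hU
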